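/- Let A be the attractor of a holomorphic IFS (G, Ω) with G = (g_1, …, g_m), and assume the strong open set condition holds with an open set O. Then every finite composition g_w of the maps g_i is a symmetry of A on each connected component D of O that intersects A, and A is J-like relative to each such component D. -/

import Mathlib

open Set Metric

noncomputable section

/-- A finite holomorphic IFS: a bounded domain `Ω ⊂ ℂ` together with finitely many
univalent maps `g i : Ω → Ω` with `closure (g i '' Ω) ⊆ Ω`. -/
structure HolIFS where
  /-- the number of maps -/
  m : ℕ
  hm : 1 ≤ m
  /-- the domain -/
  Ω : Set ℂ
  hopen : IsOpen Ω
  hconn : IsConnected Ω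
  hbdd : Bornology.IsBounded Ω
  /-- the maps of the IFS -/
  g : Fin m → ℂ → ℂ
  hdiff : ∀ i, DifferentiableOn ℂ (g i) Ω
  hinj : ∀ i, Set.InjOn (g i) Ω
  hcl : ∀ i, closure (g i '' Ω) ⊆ Ω

/-- `A` is the attractor of the IFS `S`: the (unique) nonempty compact subset of `Ω`
with `A = ⋃ i, g i '' A`. -/
def HolIFS.IsAttractor (S : HolIFS) (A : Set ℂ) : Prop :=
  A.Nonempty ∧ IsCompact A ∧ A ⊆ S.Ω ∧ A = ⋃ i, S.g i '' A

/-- The strong separation condition for the IFS `S` with attractor `A`. -/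
def HolIFS.SSC (S : HolIFS) (A : Set ℂ) : Prop :=
  ∀ i j : Fin S.m, i ≠ j → Disjoint (S.g i '' A) (S.g j '' A)

/-- For a finite word `w = [i₁, …, i_k]`, the composition `g_w = g i₁ ∘ ⋯ ∘ g i_k`. -/
def HolIFS.word (S : HolIFS) (w : List (Fin S.m)) : ℂ → ℂ :=
  w.foldr (fun i f => S.g i ∘ f) id

/-- `H` is a local holomorphic symmetry of the compact set `K` on the domain `D`. -/
def IsSymmetryOn (K D : Set ℂ) (H : ℂ → ℂ) : Prop :=
  DifferentiableOn ℂ H D ∧ ∀ x ∈ D, (x ∈ K ↔ H x ∈ K)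

/-- The set of attracting fixed points of local holomorphic symmetries of `K`. -/
def AttrFixedPts (K : Set ℂ) : Set ℂ :=
  {b | ∃ (D : Set ℂ) (H : ℂ → ℂ), IsOpen D ∧ IsConnected D ∧ (D ∩ K).Nonempty ∧
    IsSymmetryOn K D H ∧ b ∈ D ∧ H b = b ∧
    0 < ‖deriv H b‖ ∧ ‖deriv H b‖ < 1}

/-- `K` is J-like relative to `U`. -/
def JLikeRel (K U : Set ℂ) : Prop :=
  U ∩ K ⊆ closure (AttrFixedPts K)

/-- The strong open set condition for the IFS `S` with attractor `A` and open set `O`. -/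
def HolIFS.StrongOSC (S : HolIFS) (A O : Set ℂ) : Prop :=
  IsOpen O ∧ (A ∩ O).Nonempty ∧ (∀ i, S.g i '' O ⊆ O) ∧
  ∀ i j : Fin S.m, i ≠ j → Disjoint (S.g i '' O) (S.g j '' O)

open Filter Topology in
/-- A holomorphic function that is injective on an open set has nonvanishing derivative there. -/
theorem deriv_ne_zero_of_injOn {f : ℂ → ℂ} {U : Set ℂ} {b : ℂ} (hU : IsOpen U)
    (hf : DifferentiableOn ℂ f U) (hinj : InjOn f U) (hb : b ∈ U) : deriv f b ≠ 0 := by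
  intro h0
  have hnhds : ∀ z ∈ U, 𝓝 (f z) ≤ map f (𝓝 z) := by
    intro z hz
    refine (hf.analyticAt (hU.mem_nhds hz)).eventually_constant_or_nhds_le_map_nhds.resolve_left ?_
    intro hc
    obtain ⟨y, ⟨hyc, hyU⟩, hyz⟩ :=
      ((hc.and (hU.mem_nhds hz)).filter_mono nhdsWithin_le_nhds |>.and
        (eventually_mem_nhdsWithin (a := z) (s := {z}ᶜ))).exists
    exact hyz (hinj hyU hz hyc)
  have hisol : ∀ᶠ z in 𝓝[≠] b, deriv f z ≠ 0 := by
    refine (hf.analyticAt (hU.mem_nhds hb)).deriv.eventually_eq_zero_or_eventually_ne_zero.resolve_left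
      fun hz => ?_
    obtain ⟨r, hr, hball⟩ := Metric.eventually_nhds_iff_ball.1 (hz.and (hU.mem_nhds hb))
    have hconst : ∀ z ∈ ball b r, f z = f b := fun z hz =>
      isOpen_ball.is_const_of_deriv_eq_zero (convex_ball b r).isPreconnected
        (hf.mono fun y hy => (hball y hy).2) (fun y hy => (hball y hy).1) hz (mem_ball_self hr)
    obtain ⟨y, hyr, hyb⟩ :=
      ((Filter.Eventually.filter_mono nhdsWithin_le_nhds (ball_mem_nhds b hr)).and
        (eventually_mem_nhdsWithin (a := b) (s := {b}ᶜ))).exists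
    exact hyb (hinj (hball y hyr).2 hb (hconst y hyr))
  obtain ⟨r, hr, hball⟩ := Metric.eventually_nhds_iff_ball.1
    ((eventually_nhdsWithin_iff.1 hisol).and (hU.mem_nhds hb))
  set g := Function.invFunOn f U
  have hgf : ∀ z ∈ U, g (f z) = z := fun z hz => hinj.leftInvOn_invFunOn hz
  have hcont : ∀ z ∈ U, ContinuousAt g (f z) := by
    intro z hz
    have h1 : map (g ∘ f) (𝓝 z) = 𝓝 z :=
      (map_congr (eventually_of_mem (hU.mem_nhds hz) hgf)).trans map_id
    have h2 : map g (𝓝 (f z)) ≤ 𝓝 z := by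
      calc map g (𝓝 (f z)) ≤ map g (map f (𝓝 z)) := map_mono (hnhds z hz)
        _ = 𝓝 z := by rw [map_map, h1]
    rw [ContinuousAt, hgf z hz]
    exact h2
  have hV : f '' ball b r ∈ 𝓝 (f b) := hnhds b hb (image_mem_map (ball_mem_nhds b hr))
  have hgd : DifferentiableOn ℂ g (f '' ball b r) := by
    refine (Complex.differentiableOn_compl_singleton_and_continuousAt_iff hV).1 ⟨?_, hcont b hb⟩
    rintro _ ⟨⟨z, hz, rfl⟩, hzb⟩
    have hzU := (hball z hz).2
    have hne : z ≠ b := fun h => hzb (by rw [h]; rfl)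
    refine (HasDerivAt.of_local_left_inverse (f := f) (f' := deriv f z) (hcont z hzU) ?_
      ((hball z hz).1 hne) ?_).differentiableAt.differentiableWithinAt
    · rw [hgf z hzU]
      exact (hf.differentiableAt (hU.mem_nhds hzU)).hasDerivAt
    · refine hnhds z hzU (mem_map.2 ?_)
      filter_upwards [hU.mem_nhds hzU] with y hy
      exact congrArg f (hgf y hy)
  have hcomp := (hgd.differentiableAt hV).hasDerivAt.comp b
    (hf.differentiableAt (hU.mem_nhds hb)).hasDerivAt
  have hid : HasDerivAt (g ∘ f) 1 b :=
    (hasDerivAt_id b).congr_of_eventuallyEq (eventually_of_mem (hU.mem_nhds hb) hgf)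
  simpa [h0] using hcomp.unique hid

theorem Complex.norm_one_sub_conj_mul_sq_sub (a z : ℂ) :
    ‖1 - (starRingEnd ℂ) a * z‖ ^ 2 - ‖z - a‖ ^ 2 = (1 - ‖a‖ ^ 2) * (1 - ‖z‖ ^ 2) := by
  simp only [Complex.sq_norm, Complex.normSq_apply, Complex.sub_re, Complex.sub_im,
    Complex.mul_re, Complex.mul_im, Complex.conj_re, Complex.conj_im, Complex.one_re,
    Complex.one_im]
  ring

/-- A Harnack-type consequence of the Schwarz–Pick lemma for maps into the closed unit disc. -/
theorem one_sub_norm_le_of_mapsTo_closedBall {f : ℂ → ℂ} {c z : ℂ} {R : ℝ}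
    (hf : DifferentiableOn ℂ f (ball c R)) (hle : ∀ x ∈ ball c R, ‖f x‖ ≤ 1)
    (hR : 0 < R) (hz : dist z c ≤ R / 2) : 3 / 16 * (1 - ‖f c‖) ≤ 1 - ‖f z‖ := by
  have hzR : z ∈ ball c R := mem_ball.2 (by linarith)
  have hfz := hle z hzR
  rcases (hle c (mem_ball_self hR)).eq_or_lt with h1 | h1
  · rw [h1]; linarith
  set a := f c
  have hden : ∀ x ∈ ball c R, 1 - ‖a‖ ≤ ‖1 - (starRingEnd ℂ) a * f x‖ := by
    intro x hx
    have h2 := norm_sub_norm_le (1 : ℂ) ((starRingEnd ℂ) a * f x)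
    rw [norm_one, norm_mul, RCLike.norm_conj] at h2
    nlinarith [norm_nonneg a, hle x hx]
  have hden0 : ∀ x ∈ ball c R, 1 - (starRingEnd ℂ) a * f x ≠ 0 := fun x hx =>
    norm_pos_iff.1 (by linarith [hden x hx])
  set φ : ℂ → ℂ := fun x => (f x - a) / (1 - (starRingEnd ℂ) a * f x)
  have hφc : φ c = 0 := by simp [φ, a]
  have hφd : DifferentiableOn ℂ φ (ball c R) :=
    (hf.sub_const a).div ((hf.const_mul _).const_sub 1) hden0
  have hφm : MapsTo φ (ball c R) (closedBall (φ c) 1) := by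
    intro x hx
    rw [hφc, mem_closedBall_zero_iff, norm_div,
      div_le_one (norm_pos_iff.2 (hden0 x hx))]
    refine le_of_sq_le_sq ?_ (norm_nonneg _)
    have := Complex.norm_one_sub_conj_mul_sq_sub a (f x)
    have h3 : 0 ≤ (1 - ‖a‖ ^ 2) * (1 - ‖f x‖ ^ 2) :=
      mul_nonneg (by nlinarith [norm_nonneg a]) (by nlinarith [norm_nonneg (f x), hle x hx])
    linarith
  have hS := Complex.dist_le_div_mul_dist_of_mapsTo_ball hφd hφm hzR
  rw [hφc, dist_zero_right, norm_div, div_le_iff₀ (norm_pos_iff.2 (hden0 z hzR))] at hS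
  have hhalf : 1 / R * dist z c ≤ 1 / 2 := by
    rw [div_mul_eq_mul_div, one_mul, div_le_iff₀ hR]; linarith
  have hS2 : ‖f z - a‖ ≤ 1 / 2 * ‖1 - (starRingEnd ℂ) a * f z‖ :=
    hS.trans (mul_le_mul_of_nonneg_right hhalf (norm_nonneg _))
  have hid := Complex.norm_one_sub_conj_mul_sq_sub a (f z)
  have hd := hden z hzR
  have h4 : 3 / 4 * (1 - ‖a‖) ^ 2 ≤ (1 - ‖a‖ ^ 2) * (1 - ‖f z‖ ^ 2) := by
    nlinarith [norm_nonneg (f z - a), norm_nonneg (1 - (starRingEnd ℂ) a * f z)]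
  have h5 : (1 - ‖a‖ ^ 2) * (1 - ‖f z‖ ^ 2) ≤ 4 * ((1 - ‖a‖) * (1 - ‖f z‖)) := by
    have e : (1 - ‖a‖ ^ 2) * (1 - ‖f z‖ ^ 2)
        = ((1 - ‖a‖) * (1 - ‖f z‖)) * ((1 + ‖a‖) * (1 + ‖f z‖)) := by ring
    have h6 : (1 + ‖a‖) * (1 + ‖f z‖) ≤ 4 := by nlinarith [norm_nonneg a, norm_nonneg (f z)]
    have h7 : 0 ≤ (1 - ‖a‖) * (1 - ‖f z‖) := mul_nonneg (by linarith) (by linarith)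
    rw [e]; nlinarith
  have h8 : 0 < 1 - ‖a‖ := by linarith
  have h9 : (1 - ‖a‖) * (3 / 16 * (1 - ‖a‖)) ≤ (1 - ‖a‖) * (1 - ‖f z‖) := by nlinarith
  exact le_of_mul_le_mul_left h9 h8

/-- `κ` is a two-sided Harnack constant between `u` and `v` for holomorphic maps from `Ω` to the
closed unit disc. -/
def HarnackBound (Ω : Set ℂ) (κ : ℝ) (u v : ℂ) : Prop :=
  ∀ f : ℂ → ℂ, DifferentiableOn ℂ f Ω → (∀ x ∈ Ω, ‖f x‖ ≤ 1) →
    κ * (1 - ‖f u‖) ≤ 1 - ‖f v‖ ∧ κ * (1 - ‖f v‖) ≤ 1 - ‖f u‖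

theorem HarnackBound.symm {Ω : Set ℂ} {κ : ℝ} {u v : ℂ} (h : HarnackBound Ω κ u v) :
    HarnackBound Ω κ v u := fun f hf hle => (h f hf hle).symm

theorem HarnackBound.trans {Ω : Set ℂ} {κ μ : ℝ} {u v w : ℂ} (hκ : 0 ≤ κ) (hμ : 0 ≤ μ)
    (h : HarnackBound Ω κ u v) (h' : HarnackBound Ω μ v w) : HarnackBound Ω (κ * μ) u w := by
  intro f hf hle
  obtain ⟨h1, h2⟩ := h f hf hle
  obtain ⟨h3, h4⟩ := h' f hf hle
  constructor <;> nlinarith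

theorem HarnackBound.mono {Ω : Set ℂ} {κ μ : ℝ} {u v : ℂ} (hu : u ∈ Ω) (hv : v ∈ Ω)
    (hμ : μ ≤ κ) (h : HarnackBound Ω κ u v) : HarnackBound Ω μ u v := by
  intro f hf hle
  obtain ⟨h1, h2⟩ := h f hf hle
  constructor <;> nlinarith [hle u hu, hle v hv]

open Topology in
theorem eventually_harnackBound {Ω : Set ℂ} (hΩ : IsOpen Ω) {u : ℂ} (hu : u ∈ Ω) :
    ∀ᶠ v in 𝓝 u, HarnackBound Ω (3 / 16) u v := by
  obtain ⟨r, hr, hball⟩ := Metric.isOpen_iff.1 hΩ u hu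
  filter_upwards [ball_mem_nhds u (show 0 < r / 4 by linarith)] with v hv f hf hle
  rw [mem_ball] at hv
  have hsub : ball v (r / 2) ⊆ Ω := (ball_subset_ball' (by linarith)).trans hball
  refine ⟨one_sub_norm_le_of_mapsTo_closedBall (hf.mono hball) (fun x hx => hle x (hball hx)) hr
    (by linarith), one_sub_norm_le_of_mapsTo_closedBall (hf.mono hsub)
    (fun x hx => hle x (hsub hx)) (by linarith) ?_⟩
  rw [dist_comm]; linarith

theorem exists_harnackBound {Ω : Set ℂ} (hΩ : IsOpen Ω) (hc : IsPreconnected Ω) {u v : ℂ}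
    (hu : u ∈ Ω) (hv : v ∈ Ω) : ∃ κ : ℝ, 0 < κ ∧ HarnackBound Ω κ u v := by
  refine hc.induction₂ (fun u v => ∃ κ : ℝ, 0 < κ ∧ HarnackBound Ω κ u v) ?_ ?_ ?_ hu hv
  · intro x hx
    exact ((eventually_harnackBound hΩ hx).filter_mono nhdsWithin_le_nhds).mono
      fun y hy => ⟨3 / 16, by norm_num, hy⟩
  · rintro x y z _ _ _ ⟨κ, hκ, h⟩ ⟨μ, hμ, h'⟩
    exact ⟨κ * μ, mul_pos hκ hμ, h.trans hκ.le hμ.le h'⟩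
  · rintro x y _ _ ⟨κ, hκ, h⟩
    exact ⟨κ, hκ, h.symm⟩

theorem exists_harnackBound_of_isCompact {Ω K : Set ℂ} (hΩ : IsOpen Ω) (hc : IsPreconnected Ω)
    (hK : IsCompact K) (hKΩ : K ⊆ Ω) {v : ℂ} (hv : v ∈ Ω) :
    ∃ κ : ℝ, 0 < κ ∧ ∀ u ∈ K, HarnackBound Ω κ v u := by
  suffices ∃ κ : ℝ, 0 < κ ∧ ∀ u ∈ K, u ∈ Ω → HarnackBound Ω κ v u from
    this.imp fun κ h => ⟨h.1, fun u hu => h.2 u hu (hKΩ hu)⟩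
  refine hK.induction_on (p := fun s => ∃ κ : ℝ, 0 < κ ∧ ∀ u ∈ s, u ∈ Ω → HarnackBound Ω κ v u)
    ⟨1, one_pos, by simp⟩ ?_ ?_ ?_
  · rintro s t hst ⟨κ, hκ, h⟩
    exact ⟨κ, hκ, fun u hu => h u (hst hu)⟩
  · rintro s t ⟨κ, hκ, h⟩ ⟨μ, hμ, h'⟩
    refine ⟨min κ μ, lt_min hκ hμ, fun u hu huΩ => ?_⟩
    rcases hu with hu | hu
    · exact (h u hu huΩ).mono hv huΩ (min_le_left _ _)
    · exact (h' u hu huΩ).mono hv huΩ (min_le_right _ _)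
  · intro u hu
    obtain ⟨κ, hκ, h⟩ := exists_harnackBound hΩ hc hv (hKΩ hu)
    exact ⟨_, mem_nhdsWithin_of_mem_nhds (eventually_harnackBound hΩ (hKΩ hu)), κ * (3 / 16),
      by positivity, fun y hy _ => h.trans hκ.le (by norm_num) hy⟩

/-- Holomorphic maps to the closed unit disc with a zero in `K` are uniformly small on `K`. -/
theorem exists_norm_le_of_eq_zero {Ω K : Set ℂ} (hΩ : IsOpen Ω) (hc : IsConnected Ω)
    (hK : IsCompact K) (hKΩ : K ⊆ Ω) :
    ∃ r : ℝ, 0 < r ∧ r < 1 ∧ ∀ f : ℂ → ℂ, DifferentiableOn ℂ f Ω → (∀ x ∈ Ω, ‖f x‖ ≤ 1) →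
      ∀ u ∈ K, ∀ v ∈ K, f u = 0 → ‖f v‖ ≤ r := by
  obtain ⟨v₀, hv₀⟩ := hc.nonempty
  obtain ⟨κ, hκ, h⟩ := exists_harnackBound_of_isCompact hΩ hc.isPreconnected hK hKΩ hv₀
  refine ⟨max (1 / 2) (1 - κ * κ), by positivity,
    max_lt (by norm_num) (by nlinarith), fun f hf hle u hu v hv h0 => ?_⟩
  have := ((h u hu).symm.trans hκ.le hκ.le (h v hv) f hf hle).1
  rw [h0, norm_zero] at this
  exact le_max_of_le_right (by linarith)

namespace HolIFS

variable (S : HolIFS)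

theorem word_cons (i : Fin S.m) (w : List (Fin S.m)) (x : ℂ) :
    S.word (i :: w) x = S.g i (S.word w x) := rfl

theorem word_append (v w : List (Fin S.m)) (x : ℂ) :
    S.word (v ++ w) x = S.word v (S.word w x) := by
  induction v with
  | nil => rfl
  | cons i v ih => rw [List.cons_append, word_cons, ih, word_cons]

theorem word_flatten_replicate (w : List (Fin S.m)) (k : ℕ) (x : ℂ) :
    S.word (List.replicate k w).flatten x = (S.word w)^[k] x := by
  induction k with
  | zero => rfl
  | succ k ih =>
    rw [List.replicate_succ, List.flatten_cons, word_append, ih, Function.iterate_succ_apply']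

theorem mapsTo_word {T : Set ℂ} (hT : ∀ i, MapsTo (S.g i) T T) (w : List (Fin S.m)) :
    MapsTo (S.word w) T T := by
  induction w with
  | nil => exact mapsTo_id T
  | cons i w ih => exact (hT i).comp ih

theorem mapsTo_g (i : Fin S.m) : MapsTo (S.g i) S.Ω S.Ω :=
  fun _ hx => S.hcl i (subset_closure (mem_image_of_mem _ hx))

theorem mapsTo_word_domain (w : List (Fin S.m)) : MapsTo (S.word w) S.Ω S.Ω :=
  S.mapsTo_word S.mapsTo_g w

theorem differentiableOn_word (w : List (Fin S.m)) : DifferentiableOn ℂ (S.word w) S.Ω := by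
  induction w with
  | nil => exact differentiableOn_id
  | cons i w ih => exact (S.hdiff i).comp ih (S.mapsTo_word_domain w)

theorem injOn_word (w : List (Fin S.m)) : InjOn (S.word w) S.Ω := by
  induction w with
  | nil => exact injOn_id _
  | cons i w ih => exact (S.hinj i).comp ih (S.mapsTo_word_domain w)

/-- The Carathéodory-type contraction estimate behind `exists_dist_word_le`. -/
theorem exists_norm_comp_word_le :
    ∃ r : ℝ, 0 < r ∧ r < 1 ∧ ∀ (w : List (Fin S.m)) (f : ℂ → ℂ), DifferentiableOn ℂ f S.Ω →
      (∀ x ∈ S.Ω, ‖f x‖ ≤ 1) → ∀ x ∈ S.Ω, ∀ y ∈ S.Ω, f (S.word w x) = 0 →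
        ‖f (S.word w y)‖ ≤ r ^ w.length := by
  have hK : IsCompact (⋃ i, closure (S.g i '' S.Ω)) :=
    isCompact_iUnion fun i => (S.hbdd.subset (S.mapsTo_g i).image_subset).isCompact_closure
  obtain ⟨r, hr0, hr1, h⟩ := exists_norm_le_of_eq_zero S.hopen S.hconn hK (iUnion_subset S.hcl)
  have hmem : ∀ i, ∀ x ∈ S.Ω, S.g i x ∈ ⋃ i, closure (S.g i '' S.Ω) := fun i x hx =>
    mem_iUnion.2 ⟨i, subset_closure (mem_image_of_mem _ hx)⟩
  refine ⟨r, hr0, hr1, fun w => ?_⟩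
  induction w with
  | nil => intro f _ hle x _ y hy _; simpa using! hle y hy
  | cons i w ih =>
    intro f hf hle x hx y hy h0
    rw [word_cons] at h0 ⊢
    have key := ih (fun z => f (S.g i z) / r) ((hf.comp (S.hdiff i) (S.mapsTo_g i)).div_const _)
      (fun z hz => ?_) x hx y hy (by simp [h0])
    · rw [norm_div, Complex.norm_real, Real.norm_of_nonneg hr0.le, div_le_iff₀ hr0] at key
      rwa [List.length_cons, pow_succ]
    · rw [norm_div, Complex.norm_real, Real.norm_of_nonneg hr0.le, div_le_one hr0]
      exact h f hf hle _ (hmem i _ (S.mapsTo_word_domain w hx)) _ (hmem i z hz) h0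

/-- Compositions of the maps of a holomorphic IFS contract exponentially in the word length. -/
theorem exists_dist_word_le :
    ∃ C r : ℝ, 0 < r ∧ r < 1 ∧ ∀ (w : List (Fin S.m)), ∀ x ∈ S.Ω, ∀ y ∈ S.Ω,
      dist (S.word w x) (S.word w y) ≤ C * r ^ w.length := by
  obtain ⟨r, hr0, hr1, h⟩ := S.exists_norm_comp_word_le
  have hC : 0 < diam S.Ω + 1 := by linarith [diam_nonneg (s := S.Ω)]
  refine ⟨diam S.Ω + 1, r, hr0, hr1, fun w x hx y hy => ?_⟩
  have hnorm : ‖((diam S.Ω + 1 : ℝ) : ℂ)‖ = diam S.Ω + 1 := by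
    rw [Complex.norm_real, Real.norm_of_nonneg hC.le]
  have key := h w (fun z => (z - S.word w x) / ((diam S.Ω + 1 : ℝ) : ℂ))
    ((differentiableOn_id.sub_const _).div_const _) (fun z hz => ?_) x hx y hy (by simp)
  · rw [norm_div, hnorm, div_le_iff₀ hC, ← dist_eq_norm, dist_comm] at key
    linarith
  · rw [norm_div, hnorm, div_le_one hC, ← dist_eq_norm]
    linarith [dist_le_diam_of_mem S.hbdd hz (S.mapsTo_word_domain w hx)]

theorem exists_dist_word_lt {ε : ℝ} (hε : 0 < ε) :
    ∃ N : ℕ, ∀ w : List (Fin S.m), N ≤ w.length → ∀ x ∈ S.Ω, ∀ y ∈ S.Ω,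
      dist (S.word w x) (S.word w y) < ε := by
  obtain ⟨C, r, hr0, hr1, h⟩ := S.exists_dist_word_le
  have hlim := (tendsto_pow_atTop_nhds_zero_of_lt_one hr0.le hr1).const_mul C
  rw [mul_zero] at hlim
  obtain ⟨N, hN⟩ := Filter.eventually_atTop.1 (hlim.eventually_lt_const hε)
  exact ⟨N, fun w hw x hx y hy => (h w x hx y hy).trans_lt (hN _ hw)⟩

variable {S} {A O : Set ℂ}

theorem IsAttractor.mapsTo_g (hA : S.IsAttractor A) (i : Fin S.m) : MapsTo (S.g i) A A := by
  intro x hx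
  rw [hA.2.2.2]
  exact mem_iUnion.2 ⟨i, mem_image_of_mem _ hx⟩

theorem IsAttractor.exists_word_eq (hA : S.IsAttractor A) (n : ℕ) {z : ℂ} (hz : z ∈ A) :
    ∃ w : List (Fin S.m), w.length = n ∧ ∃ a ∈ A, S.word w a = z := by
  induction n generalizing z with
  | zero => exact ⟨[], rfl, z, hz, rfl⟩
  | succ n ih =>
    rw [hA.2.2.2] at hz
    obtain ⟨i, y, hy, rfl⟩ := mem_iUnion.1 hz
    obtain ⟨w, hw, a, ha, rfl⟩ := ih hy
    exact ⟨i :: w, by simp [hw], a, ha, rfl⟩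

theorem IsAttractor.exists_word_fixedPoint (hA : S.IsAttractor A) {w : List (Fin S.m)}
    (hw : w ≠ []) : ∃ b ∈ A, S.word w b = b := by
  have hmaps := S.mapsTo_word hA.mapsTo_g w
  have hcont : ContinuousOn (S.word w) A :=
    (S.differentiableOn_word w).continuousOn.mono hA.2.2.1
  obtain ⟨b, hb, hmin⟩ := hA.2.1.exists_isMinOn hA.1 (continuous_dist.comp_continuousOn (hcont.prodMk continuousOn_id))
  refine ⟨b, hb, dist_le_zero.1 (le_of_forall_pos_lt_add fun ε hε => ?_)⟩
  obtain ⟨N, hN⟩ := S.exists_dist_word_lt hε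
  have hlen : N ≤ (List.replicate N w).flatten.length := by
    rw [List.length_flatten, List.map_replicate, List.sum_replicate, smul_eq_mul]
    exact Nat.le_mul_of_pos_right N (List.length_pos_iff.2 hw)
  have hlt := hN _ hlen _ (hA.2.2.1 (hmaps hb)) _ (hA.2.2.1 hb)
  rw [word_flatten_replicate, word_flatten_replicate, ← Function.iterate_succ_apply,
    Function.iterate_succ_apply'] at hlt
  rw [zero_add]
  exact (isMinOn_iff.1 hmin _ (hmaps.iterate N hb)).trans_lt hlt

theorem StrongOSC.mapsTo_g (hO : S.StrongOSC A O) (i : Fin S.m) : MapsTo (S.g i) O O :=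
  mapsTo_iff_image_subset.2 (hO.2.2.1 i)

theorem StrongOSC.subset_closure (hA : S.IsAttractor A) (hO : S.StrongOSC A O) :
    A ⊆ closure O := by
  intro z hz
  obtain ⟨a₀, ha₀, ha₀O⟩ := hO.2.1
  refine Metric.mem_closure_iff.2 fun ε hε => ?_
  obtain ⟨N, hN⟩ := S.exists_dist_word_lt hε
  obtain ⟨w, hw, a, ha, rfl⟩ := hA.exists_word_eq N hz
  exact ⟨S.word w a₀, S.mapsTo_word hO.mapsTo_g w ha₀O,
    hN w hw.ge a (hA.2.2.1 ha) a₀ (hA.2.2.1 ha₀)⟩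

theorem image_g_mem_nhds (hO : IsOpen O) (hOsub : O ⊆ S.Ω) (i : Fin S.m) {x : ℂ} (hx : x ∈ O) :
    S.g i '' O ∈ nhds (S.g i x) := by
  have hd := ((S.hdiff i).analyticAt (S.hopen.mem_nhds (hOsub hx))).hasStrictDerivAt
  rw [← hd.map_nhds_eq (deriv_ne_zero_of_injOn S.hopen (S.hdiff i) (S.hinj i) (hOsub hx))]
  exact Filter.image_mem_map (hO.mem_nhds hx)

theorem StrongOSC.g_mem_iff (hA : S.IsAttractor A) (hOsub : O ⊆ S.Ω) (hO : S.StrongOSC A O)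
    (i : Fin S.m) {x : ℂ} (hx : x ∈ O) : S.g i x ∈ A ↔ x ∈ A := by
  refine ⟨fun h => ?_, fun h => hA.mapsTo_g i h⟩
  rw [hA.2.2.2] at h
  obtain ⟨j, y, hy, hyx⟩ := mem_iUnion.1 h
  have hyΩ := hA.2.2.1 hy
  obtain rfl | hij := eq_or_ne j i
  · rwa [← S.hinj j hyΩ (hOsub hx) hyx]
  · have hnhds := image_g_mem_nhds hO.1 hOsub i hx
    rw [← hyx] at hnhds
    have hcont := ((S.hdiff j).differentiableAt (S.hopen.mem_nhds hyΩ)).continuousAt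
    obtain ⟨u, hu, huO⟩ := mem_closure_iff_nhds.1 (hO.subset_closure hA hy) _ (hcont hnhds)
    exact (Set.disjoint_left.1 (hO.2.2.2 i j hij.symm) hu (mem_image_of_mem _ huO)).elim

theorem StrongOSC.word_mem_iff (hA : S.IsAttractor A) (hOsub : O ⊆ S.Ω) (hO : S.StrongOSC A O)
    (w : List (Fin S.m)) {x : ℂ} (hx : x ∈ O) : S.word w x ∈ A ↔ x ∈ A := by
  induction w with
  | nil => rfl
  | cons i w ih =>
    rw [word_cons, hO.g_mem_iff hA hOsub i (S.mapsTo_word hO.mapsTo_g w hx), ih]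

theorem StrongOSC.isSymmetryOn_word (hA : S.IsAttractor A) (hOsub : O ⊆ S.Ω)
    (hO : S.StrongOSC A O) (w : List (Fin S.m)) {D : Set ℂ} (hD : D ⊆ O) :
    IsSymmetryOn A D (S.word w) :=
  ⟨(S.differentiableOn_word w).mono (hD.trans hOsub),
    fun _ hx => (hO.word_mem_iff hA hOsub w (hD hx)).symm⟩

theorem StrongOSC.jLikeRel (hA : S.IsAttractor A) (hOsub : O ⊆ S.Ω)
    (hO : S.StrongOSC A O) {D : Set ℂ} (hDo : IsOpen D) (hDc : IsPreconnected D) (hD : D ⊆ O) :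
    JLikeRel A D := by
  rintro z ⟨hzD, hzA⟩
  refine Metric.mem_closure_iff.2 fun ε hε => ?_
  obtain ⟨ρ, hρ, hball⟩ := Metric.isOpen_iff.1 hDo z hzD
  obtain ⟨N, hN⟩ := S.exists_dist_word_lt (ε := min ε (ρ / 4)) (lt_min hε (by linarith))
  obtain ⟨w, hw, a, ha, rfl⟩ := hA.exists_word_eq (N + 1) hzA
  have hdist := hN w (by omega)
  obtain ⟨b, hbA, hb⟩ := hA.exists_word_fixedPoint (w := w) (by rintro rfl; simp at hw)
  have hbΩ := hA.2.2.1 hbA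
  have hzb : dist (S.word w a) b < min ε (ρ / 4) := by
    simpa only [hb] using hdist a (hA.2.2.1 ha) b hbΩ
  obtain ⟨hzbε, hzbρ⟩ := lt_min_iff.1 hzb
  have hbD : b ∈ D := hball (by rw [mem_ball, dist_comm]; linarith)
  have hsub : ball b (ρ / 2) ⊆ S.Ω :=
    (ball_subset_ball' (by rw [dist_comm]; linarith)).trans (hball.trans (hD.trans hOsub))
  refine ⟨b, ⟨D, S.word w, hDo, ⟨⟨b, hbD⟩, hDc⟩, ⟨b, hbD, hbA⟩,
    hO.isSymmetryOn_word hA hOsub w hD, hbD, hb, ?_, ?_⟩, hzbε⟩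
  · exact norm_pos_iff.2
      (deriv_ne_zero_of_injOn S.hopen (S.differentiableOn_word w) (S.injOn_word w) hbΩ)
  · have hmaps : MapsTo (S.word w) (ball b (ρ / 2)) (closedBall (S.word w b) (ρ / 4)) :=
      fun x hx => mem_closedBall.2
        ((hdist x (hsub hx) b hbΩ).le.trans (min_le_right _ _))
    refine (Complex.norm_deriv_le_div_of_mapsTo_ball ((S.differentiableOn_word w).mono hsub) hmaps
      (by linarith)).trans_lt ?_
    rw [div_lt_one (by linarith)]
    linarith

end HolIFS

/-- Lemma: if the strong OSC holds with the open set `O ⊆ Ω`, then every finite composition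
`g_w` is a symmetry of the attractor `A` on each connected component `D` of `O` that
intersects `A`, and `A` is J-like relative to each such `D`. -/
theorem stmt_8 (S : HolIFS) (A : Set ℂ) (hA : S.IsAttractor A) (hA2 : A.Nontrivial)
    (O : Set ℂ) (hOsub : O ⊆ S.Ω) (hOSC : S.StrongOSC A O) :
    ∀ x ∈ O, (connectedComponentIn O x ∩ A).Nonempty →
      (∀ w : List (Fin S.m), w ≠ [] →
        IsSymmetryOn A (connectedComponentIn O x) (S.word w)) ∧
      JLikeRel A (connectedComponentIn O x) := by
  intro x _ _
  exact ⟨fun w _ => hOSC.isSymmetryOn_word hA hOsub w (connectedComponentIn_subset O x),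
    hOSC.jLikeRel hA hOsub hOSC.1.connectedComponentIn isPreconnected_connectedComponentIn
      (connectedComponentIn_subset O x)⟩
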